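/- Let R be a nonnegative random variable with E[R²] > 0 and E[R⁴ e^{tR}] < ∞ for all t > 0, and let ρ_D > 0. For each n > 0, let ρ_n denote the unique positive solution of (n/ρ)(E[e^{ρR/√n}] − 1 − (ρ/√n) E[R]) = (ρ_D/2) E[R²]. If C > ρ_D² E[R³] / (3 E[R²]), then there exists N > 0 such that for all n ≥ N: 0 < ρ_D − C/√n < ρ_n < ρ_D. In particular, lim_{n→∞} ρ_n = ρ_D with |ρ_n − ρ_D| ≤ C/√n for all n ≥ N. -/

import Mathlib

open MeasureTheory Real Filter Set

theorem aux_exp_lower (y : ℝ) (hy : 0 ≤ y) : 1 + y + y ^ 2 / 2 + y ^ 3 / 6 ≤ Real.exp y := by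
  have h := Real.sum_le_exp_of_nonneg hy 4
  simp [Finset.sum_range_succ, Nat.factorial] at h
  linarith

theorem aux_exp_upper (y : ℝ) (hy : 0 ≤ y) :
    Real.exp y ≤ 1 + y + y ^ 2 / 2 + y ^ 3 / 6 + y ^ 4 * Real.exp y := by
  have h := Complex.norm_exp_sub_sum_le_norm_mul_exp (y : ℂ) 4
  have e : Complex.exp (y : ℂ) - ∑ m ∈ Finset.range 4, (y : ℂ) ^ m / (m.factorial : ℂ)
      = ((Real.exp y - (1 + y + y ^ 2 / 2 + y ^ 3 / 6) : ℝ) : ℂ) := by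
    simp [Finset.sum_range_succ, Nat.factorial]
  rw [e, Complex.norm_real, Complex.norm_real, Real.norm_eq_abs, Real.norm_eq_abs,
    abs_of_nonneg hy] at h
  linarith [le_abs_self (Real.exp y - (1 + y + y ^ 2 / 2 + y ^ 3 / 6))]

/-- Lemma 3.2 (analytic content): let `R ≥ 0` with `E[R²] > 0` and `E[R⁴e^{tR}] < ∞` for all
`t > 0`, and let `ρ_D > 0`.  If, for each `n > 0`, `ρ_n` is the unique positive solution of
`(n/ρ)(E[e^{ρR/√n}] − 1 − (ρ/√n)E[R]) = (ρ_D/2)E[R²]`, and `C > ρ_D²E[R³]/(3E[R²])`, then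
there exists `N > 0` such that `0 < ρ_D − C/√n < ρ_n < ρ_D` and `|ρ_n − ρ_D| ≤ C/√n` for all
`n ≥ N`; in particular `ρ_n → ρ_D` as `n → ∞`. -/
theorem scaled_adjustment_converges_to_diffusion
    {Ω : Type*} [MeasurableSpace Ω] (μ : Measure Ω) [IsProbabilityMeasure μ]
    (R : Ω → ℝ) (hRmeas : Measurable R) (hRnonneg : ∀ ω, 0 ≤ R ω)
    (hR2pos : 0 < ∫ ω, (R ω) ^ 2 ∂μ)
    (hInt : ∀ t : ℝ, 0 < t → Integrable (fun ω => (R ω) ^ 4 * Real.exp (t * R ω)) μ)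
    (ρD : ℝ) (hρD : 0 < ρD)
    (ρ : ℝ → ℝ)
    (hρ : ∀ n : ℝ, 0 < n → 0 < ρ n ∧
      (n / ρ n) * ((∫ ω, Real.exp (ρ n * R ω / Real.sqrt n) ∂μ) - 1
          - (ρ n / Real.sqrt n) * ∫ ω, R ω ∂μ)
        = (ρD / 2) * ∫ ω, (R ω) ^ 2 ∂μ)
    (C : ℝ) (hC : ρD ^ 2 * (∫ ω, (R ω) ^ 3 ∂μ) / (3 * ∫ ω, (R ω) ^ 2 ∂μ) < C) :
    (∃ N : ℝ, 0 < N ∧ ∀ n : ℝ, N ≤ n →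
      0 < ρD - C / Real.sqrt n ∧ ρD - C / Real.sqrt n < ρ n ∧ ρ n < ρD ∧
      |ρ n - ρD| ≤ C / Real.sqrt n) ∧
    Filter.Tendsto ρ Filter.atTop (nhds ρD) := by
  -- integrability
  have hE : ∀ t : ℝ, 0 < t → Integrable (fun ω => Real.exp (t * R ω)) μ := by
    intro t ht
    refine ((integrable_const (Real.exp t)).add (hInt t ht)).mono' (by fun_prop) ?_
    refine Eventually.of_forall fun ω => ?_
    rw [Real.norm_eq_abs, abs_of_pos (Real.exp_pos _)]
    simp only [Pi.add_apply]
    rcases le_total (R ω) 1 with h | h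
    · have h1 : Real.exp (t * R ω) ≤ Real.exp t := Real.exp_le_exp.2 (by nlinarith)
      have h2 : 0 ≤ R ω ^ 4 * Real.exp (t * R ω) := by positivity
      linarith
    · have h1 : 1 ≤ R ω ^ 4 := one_le_pow₀ h
      have := Real.exp_pos t
      nlinarith [Real.exp_pos (t * R ω)]
  have hP : ∀ k : ℕ, k ≤ 4 → Integrable (fun ω => R ω ^ k) μ := by
    intro k hk
    refine ((integrable_const (1 : ℝ)).add (hInt 1 one_pos)).mono' (by fun_prop) ?_
    refine Eventually.of_forall fun ω => ?_
    have h0 := hRnonneg ω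
    rw [Real.norm_eq_abs, abs_of_nonneg (by positivity)]
    simp only [Pi.add_apply]
    have he : 1 ≤ Real.exp (1 * R ω) := Real.one_le_exp (by linarith)
    have h4 : 0 ≤ R ω ^ 4 := by positivity
    rcases le_total (R ω) 1 with h | h
    · have h1 : R ω ^ k ≤ 1 := pow_le_one₀ h0 h
      nlinarith
    · have h1 : R ω ^ k ≤ R ω ^ 4 := pow_le_pow_right₀ h hk
      nlinarith
  have hI1 : Integrable R μ := by simpa using hP 1 (by norm_num)
  have hI2 := hP 2 (by norm_num)
  have hI3 := hP 3 (by norm_num)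
  have hIK := hInt ρD hρD
  -- positivity of the third moment
  have hm3 : 0 < ∫ ω, (R ω) ^ 3 ∂μ := by
    rw [integral_pos_iff_support_of_nonneg (fun ω => by have := hRnonneg ω; positivity) hI3]
    rw [integral_pos_iff_support_of_nonneg (fun ω => by positivity) hI2] at hR2pos
    convert hR2pos using 2
    ext ω
    simp
  have hK : 0 ≤ ∫ ω, (R ω) ^ 4 * Real.exp (ρD * R ω) ∂μ :=
    integral_nonneg fun ω => by positivity
  set m1 := ∫ ω, R ω ∂μ with hm1d
  set m2 := ∫ ω, (R ω) ^ 2 ∂μ with hm2d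
  set m3 := ∫ ω, (R ω) ^ 3 ∂μ with hm3d
  set K := ∫ ω, (R ω) ^ 4 * Real.exp (ρD * R ω) ∂μ with hKd
  have hCpos : 0 < C := lt_trans (by positivity) hC
  have hC' : ρD ^ 2 * m3 < C * (3 * m2) := (div_lt_iff₀ (by positivity)).1 hC
  -- core estimates
  have key : ∀ n : ℝ, 1 ≤ n → 
      ρ n * m2 / 2 + ρ n ^ 2 * (√n)⁻¹ * m3 / 6 ≤ ρD * m2 / 2 ∧
      (ρ n ≤ ρD → ρD * m2 / 2 ≤
        ρ n * m2 / 2 + ρ n ^ 2 * (√n)⁻¹ * m3 / 6 + ρ n ^ 3 * (√n)⁻¹ ^ 2 * K) := by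
    intro n hn
    obtain ⟨hr, heq⟩ := hρ n (by linarith)
    set r := ρ n
    have hsq : 1 ≤ √n := Real.one_le_sqrt.2 hn
    set s := (√n)⁻¹ with hs
    have hs0 : 0 < s := by positivity
    have hs1 : s ≤ 1 := inv_le_one_of_one_le₀ hsq
    have hns : n = (s ^ 2)⁻¹ := by
      rw [hs, inv_pow, inv_inv, Real.sq_sqrt (by linarith)]
    have hexp : ∀ ω, r * R ω / √n = r * s * R ω := fun ω => by rw [hs]; ring
    simp only [hexp] at heq
    rw [show r / √n = r * s by rw [hs]; ring] at heq
    have hIe := hE (r * s) (by positivity)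
    have heq2 : (∫ ω, Real.exp (r * s * R ω) ∂μ) = 1 + r * s * m1 + r * s ^ 2 * (ρD / 2 * m2) := by
      rw [← heq]
      have : n / r * (r * s ^ 2) = 1 := by rw [hns]; field_simp
      linear_combination (-1) * ((∫ ω, Real.exp (r * s * R ω) ∂μ) - 1 - r * s * m1) * this
    have hIp : Integrable (fun ω => 1 + r * s * R ω + (r * s) ^ 2 / 2 * R ω ^ 2
        + (r * s) ^ 3 / 6 * R ω ^ 3) μ :=
      (((integrable_const _).add (hI1.const_mul _)).add (hI2.const_mul _)).add (hI3.const_mul _)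
    have hip : ∫ ω, (1 + r * s * R ω + (r * s) ^ 2 / 2 * R ω ^ 2
        + (r * s) ^ 3 / 6 * R ω ^ 3) ∂μ
        = 1 + r * s * m1 + (r * s) ^ 2 / 2 * m2 + (r * s) ^ 3 / 6 * m3 := by
      have q1 : Integrable (fun ω => 1 + r * s * R ω) μ :=
        (integrable_const _).add (hI1.const_mul _)
      have q2 : Integrable (fun ω => 1 + r * s * R ω + (r * s) ^ 2 / 2 * R ω ^ 2) μ :=
        q1.add (hI2.const_mul _)
      rw [integral_add q2 (hI3.const_mul _), integral_add q1 (hI2.const_mul _),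
        integral_add (integrable_const _) (hI1.const_mul _)]
      simp only [integral_const_mul]
      simp [hm1d, hm2d, hm3d]
    have hrs : 0 < r * s ^ 2 := by positivity
    constructor
    · have h := integral_mono hIp hIe (fun ω => by
        have h0 := hRnonneg ω
        have := aux_exp_lower (r * s * R ω) (by positivity)
        show _ ≤ Real.exp (r * s * R ω)
        refine le_trans (le_of_eq ?_) this
        ring)
      rw [hip, heq2] at h
      refine le_of_mul_le_mul_left ?_ hrs
      linarith
    · intro hle
      have h := integral_mono hIe (hIp.add (hIK.const_mul ((r * s) ^ 4))) (fun ω => by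
        have h0 := hRnonneg ω
        have h1 := aux_exp_upper (r * s * R ω) (by positivity)
        have h2 : Real.exp (r * s * R ω) ≤ Real.exp (ρD * R ω) :=
          Real.exp_le_exp.2 (mul_le_mul_of_nonneg_right (by nlinarith) h0)
        have h3 : (r * s * R ω) ^ 4 * Real.exp (r * s * R ω)
          ≤ (r * s * R ω) ^ 4 * Real.exp (ρD * R ω) :=
          mul_le_mul_of_nonneg_left h2 (by positivity)
        show Real.exp (r * s * R ω) ≤ (1 + r * s * R ω + (r * s) ^ 2 / 2 * R ω ^ 2
          + (r * s) ^ 3 / 6 * R ω ^ 3) + (r * s) ^ 4 * (R ω ^ 4 * Real.exp (ρD * R ω))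
        linarith)
      rw [heq2, integral_add' hIp (hIK.const_mul ((r * s) ^ 4)), hip, integral_const_mul] at h
      refine le_of_mul_le_mul_left ?_ hrs
      linarith
  have hs : Tendsto (fun n : ℝ => (√n)⁻¹) atTop (nhds 0) :=
    tendsto_inv_atTop_zero.comp Real.tendsto_sqrt_atTop
  have hev : ∀ᶠ n : ℝ in atTop, 0 < ρD - C / √n ∧ ρD - C / √n < ρ n ∧ ρ n < ρD ∧
      |ρ n - ρD| ≤ C / √n := by
    have e1 : ∀ᶠ n : ℝ in atTop, (√n)⁻¹ * C < ρD := by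
      have := hs.mul_const C
      rw [zero_mul] at this
      exact this.eventually_lt_const hρD
    have e2 : ∀ᶠ n : ℝ in atTop, (√n)⁻¹ * (6 * ρD ^ 3 * K) < C * (3 * m2) - ρD ^ 2 * m3 := by
      have := hs.mul_const (6 * ρD ^ 3 * K)
      rw [zero_mul] at this
      exact this.eventually_lt_const (by linarith)
    filter_upwards [e1, e2, eventually_ge_atTop 1] with n h1 h2 hn
    obtain ⟨k1, k2⟩ := key n hn
    have hr := (hρ n (by linarith)).1
    have hs0 : 0 < (√n)⁻¹ := by
      have : 0 < √n := Real.sqrt_pos.2 (by linarith)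
      positivity
    rw [div_eq_mul_inv]
    set s := (√n)⁻¹
    have hlt : ρ n < ρD := by
      have : 0 < ρ n ^ 2 * s * m3 := by positivity
      have : ρ n * m2 < ρD * m2 := by linarith
      exact lt_of_mul_lt_mul_right this hR2pos.le
    have k3 := k2 hlt.le
    have p2 : ρ n ^ 2 * s * m3 ≤ ρD ^ 2 * s * m3 := by gcongr
    have p3 : ρ n ^ 3 * s ^ 2 * K ≤ ρD ^ 3 * s ^ 2 * K := by gcongr
    have h2' := mul_lt_mul_of_pos_left h2 hs0
    have hgt : ρD - C * s < ρ n := by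
      have : (ρD - C * s) * m2 < ρ n * m2 := by nlinarith
      exact lt_of_mul_lt_mul_right this hR2pos.le
    refine ⟨by linarith, hgt, hlt, ?_⟩
    rw [abs_le]
    constructor <;> nlinarith
  constructor
  · obtain ⟨N, hN⟩ := eventually_atTop.1 hev
    exact ⟨max N 1, by positivity, fun n hn => hN n (le_trans (le_max_left _ _) hn)⟩
  · have hl : Tendsto (fun n : ℝ => ρD - C / √n) atTop (nhds ρD) := by
      have := (hs.const_mul C).const_sub ρD
      simpa [div_eq_mul_inv] using this
    exact tendsto_of_tendsto_of_tendsto_of_le_of_le' hl tendsto_const_nhds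
      (hev.mono fun n h => h.2.1.le) (hev.mono fun n h => h.2.2.1.le)
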